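/- arXiv:math/0209061 — 2 statements merged into one kernel-verified Lean document; each statement's English description precedes it below -/
import Mathlib

section
/- Let p and q be positive integers and let X be the simplicial complex of all subsets of Fin p × Fin q containing no vertical path; its facets are the complements of graphs of horizontal paths. Then X is shellable: there is a linear ordering F₁, F₂, …, F_m of all the facets of X such that for all 1 ≤ i < j ≤ m there exist k < j and an element v ∈ F_j with F_i ∩ F_j ⊆ F_k ∩ F_j and F_k ∩ F_j = F_j \ {v}. -/
/-- `F` contains no vertical path: for every nondecreasing `α : Fin p → Fin q`,
the graph of `α` is not contained in `F`. -/
def containsNoVerticalPath {p q : ℕ} (F : Finset (Fin p × Fin q)) : Prop :=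
  ∀ α : Fin p → Fin q, Monotone α → ∃ i : Fin p, (i, α i) ∉ F

/-- `F` is a facet (maximal face) of the complex `X` of subsets of the grid
containing no vertical path. -/
def isFacetX {p q : ℕ} (F : Finset (Fin p × Fin q)) : Prop :=
  containsNoVerticalPath F ∧
    ∀ G : Finset (Fin p × Fin q), containsNoVerticalPath G → F ⊆ G → G = F

/-- The complement of the graph of `β`, viewed as a horizontal path. -/
def horizontalCompl {p q : ℕ} (β : Fin q → Fin p) : Finset (Fin p × Fin q) :=
  Finset.univ.filter fun x => x.1 ≠ β x.2

theorem mem_horizontalCompl {p q : ℕ} {β : Fin q → Fin p} {x : Fin p × Fin q} :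
    x ∈ horizontalCompl β ↔ x.1 ≠ β x.2 := by
  simp [horizontalCompl]

theorem eq_of_horizontalCompl_subset {p q : ℕ} {β γ : Fin q → Fin p}
    (h : horizontalCompl β ⊆ horizontalCompl γ) : β = γ := by
  funext j
  by_contra hne
  have hmem : (γ j, j) ∈ horizontalCompl β := mem_horizontalCompl.2 fun e => hne e.symm
  exact mem_horizontalCompl.1 (h hmem) rfl

theorem Monotone.exists_fixed_point_fin {p : ℕ} (hp : 0 < p) {f : Fin p → Fin p}
    (hf : Monotone f) : ∃ i, f i = i := by
  obtain ⟨m, hm, hmax⟩ := (Finset.univ.filter fun i => i ≤ f i).exists_max_image id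
    ⟨⟨0, hp⟩, Finset.mem_filter.2 ⟨Finset.mem_univ _, Nat.zero_le _⟩⟩
  have hm' : m ≤ f m := by simpa using hm
  exact ⟨m, le_antisymm (hmax (f m) (by simpa using hf hm')) hm'⟩

/-- Every vertical path meets every horizontal path. -/
theorem containsNoVerticalPath_horizontalCompl {p q : ℕ} (hp : 0 < p) {β : Fin q → Fin p}
    (hβ : Monotone β) : containsNoVerticalPath (horizontalCompl β) := by
  intro α hα
  obtain ⟨i, hi⟩ := (hβ.comp hα).exists_fixed_point_fin hp
  exact ⟨i, fun h => mem_horizontalCompl.1 h hi.symm⟩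

/-- A set without vertical paths misses some horizontal path. -/
theorem containsNoVerticalPath.exists_subset_horizontalCompl {p q : ℕ}
    {F : Finset (Fin p × Fin q)} (hF : containsNoVerticalPath F) :
    ∃ β : Fin q → Fin p, Monotone β ∧ F ⊆ horizontalCompl β := by
  classical
  let P : Fin p → ℕ → Prop := fun i n => ∃ β : Fin q → Fin p,
    Monotone β ∧ (∀ j, β j ≤ i) ∧ ∀ j : Fin q, j.val < n → (β j, j) ∉ F
  have P_zero (i : Fin p) : P i 0 :=
    ⟨fun _ => i, monotone_const, fun _ => le_rfl, fun j hj => absurd hj (Nat.not_lt_zero _)⟩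
  have P_mono {i i' : Fin p} (h : i ≤ i') (n : ℕ) : P i n → P i' n := by
    rintro ⟨β, h1, h2, h3⟩
    exact ⟨β, h1, fun j => (h2 j).trans h, h3⟩
  have P_findGreatest (i : Fin p) : P i (Nat.findGreatest (P i) q) :=
    Nat.findGreatest_spec (Nat.zero_le q) (P_zero i)
  by_cases hfull : ∃ i, P i q
  · obtain ⟨i, β, h1, -, h3⟩ := hfull
    refine ⟨β, h1, fun x hx => mem_horizontalCompl.2 fun e => h3 x.2 x.2.isLt ?_⟩
    rwa [← e]
  · push Not at hfull
    have hlt (i : Fin p) : Nat.findGreatest (P i) q < q := by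
      refine lt_of_le_of_ne (Nat.findGreatest_le q) fun e => hfull i ?_
      have h := P_findGreatest i
      rwa [e] at h
    obtain ⟨i, hi⟩ := hF (fun i => ⟨Nat.findGreatest (P i) q, hlt i⟩) fun i i' h =>
      Nat.findGreatest_mono_left (P_mono h) q
    obtain ⟨β, h1, h2, h3⟩ := P_findGreatest i
    have hsucc : P i (Nat.findGreatest (P i) q + 1) := by
      refine ⟨fun j => if j.val < Nat.findGreatest (P i) q then β j else i, ?_, ?_, ?_⟩
      · intro a b hab
        have hab' : a.val ≤ b.val := hab
        dsimp only
        split_ifs with ha hb hb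
        · exact h1 hab
        · exact h2 a
        · omega
        · exact le_rfl
      · intro j
        dsimp only
        split_ifs
        · exact h2 j
        · exact le_rfl
      · intro j hj
        dsimp only
        split_ifs with h
        · exact h3 j h
        · have e : j = ⟨Nat.findGreatest (P i) q, hlt i⟩ := Fin.ext (by dsimp only; omega)
          rw [e]
          exact hi
    have := Nat.le_findGreatest (hlt i) hsucc
    omega

theorem isFacetX_iff_exists_horizontalCompl {p q : ℕ} (hp : 0 < p)
    {F : Finset (Fin p × Fin q)} :
    isFacetX F ↔ ∃ β : Fin q → Fin p, Monotone β ∧ horizontalCompl β = F := by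
  constructor
  · rintro ⟨hF, hmax⟩
    obtain ⟨β, hβ, hsub⟩ := hF.exists_subset_horizontalCompl
    exact ⟨β, hβ, hmax _ (containsNoVerticalPath_horizontalCompl hp hβ) hsub⟩
  · rintro ⟨β, hβ, rfl⟩
    refine ⟨containsNoVerticalPath_horizontalCompl hp hβ, fun G hG hsub => ?_⟩
    obtain ⟨γ, -, hGγ⟩ := hG.exists_subset_horizontalCompl
    obtain rfl := eq_of_horizontalCompl_subset (hsub.trans hGγ)
    exact hGγ.antisymm hsub

/-- Lowering a monotone `γ` to the value of a monotone `β` at the first place where they differ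
keeps it monotone. -/
theorem Monotone.update_of_eq_of_lt {ι κ : Type*} [LinearOrder ι] [Preorder κ] {β γ : ι → κ}
    (hβ : Monotone β) (hγ : Monotone γ) {c : ι} (heq : ∀ j < c, β j = γ j) (hc : β c ≤ γ c) :
    Monotone (Function.update γ c (β c)) := by
  intro a b hab
  by_cases ha : a = c <;> by_cases hb : b = c
  · simp [ha, hb]
  · subst ha
    simpa [hb] using hc.trans (hγ hab)
  · subst hb
    simpa [ha, ← heq a (lt_of_le_of_ne hab ha)] using hβ hab
  · simpa [ha, hb] using hγ hab

/-- The simplicial complex `X` of subsets of `Fin p × Fin q` containing no vertical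
path is shellable: its facets can be ordered `L 0, L 1, …` so that for all `i < j`
there are `k < j` and `v ∈ L j` with `L i ∩ L j ⊆ L k ∩ L j` and `L k ∩ L j = L j \ {v}`. -/
theorem no_vertical_path_complex_shellable (p q : ℕ) (hp : 0 < p) (hq : 0 < q) :
    ∃ (m : ℕ) (L : Fin m → Finset (Fin p × Fin q)),
      Function.Injective L ∧
      (∀ F : Finset (Fin p × Fin q), isFacetX F ↔ ∃ i : Fin m, L i = F) ∧
      (∀ i j : Fin m, i < j → ∃ k : Fin m, k < j ∧ ∃ v ∈ L j,
        L i ∩ L j ⊆ L k ∩ L j ∧ L k ∩ L j = L j \ {v}) := by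
  classical
  let M := {β : Lex (Fin q → Fin p) // Monotone (ofLex β)}
  let e : Fin (Fintype.card M) ≃o M := Fintype.orderIsoFinOfCardEq M rfl
  refine ⟨Fintype.card M, fun i => horizontalCompl (ofLex (e i).1), ?_, ?_, ?_⟩
  · intro i j h
    exact e.injective (Subtype.ext (ofLex.injective (eq_of_horizontalCompl_subset h.subset)))
  · intro F
    rw [isFacetX_iff_exists_horizontalCompl hp]
    constructor
    · rintro ⟨β, hβ, rfl⟩
      exact ⟨e.symm ⟨toLex β, hβ⟩, by simp⟩
    · rintro ⟨i, rfl⟩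
      exact ⟨_, (e i).2, rfl⟩
  · intro i j hij
    have hlex : (e i).1 < (e j).1 := e.lt_iff_lt.2 hij
    set β := ofLex (e i).1
    set γ := ofLex (e j).1 with hγ
    obtain ⟨c, heq, hlt⟩ : ∃ c, (∀ a < c, β a = γ a) ∧ β c < γ c := hlex
    let δ : M := ⟨toLex (Function.update γ c (β c)),
      (e i).2.update_of_eq_of_lt (e j).2 heq hlt.le⟩
    have hδ : ofLex (e (e.symm δ)).1 = Function.update γ c (β c) := by
      rw [e.apply_symm_apply]; rfl
    refine ⟨e.symm δ, ?_, (β c, c), mem_horizontalCompl.2 hlt.ne, ?_, ?_⟩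
    · rw [e.symm_apply_lt]
      exact Pi.toLex_update_lt_self_iff.2 hlt
    · rintro ⟨a, b⟩ h
      rw [Finset.mem_inter, mem_horizontalCompl, mem_horizontalCompl] at h
      rw [Finset.mem_inter, mem_horizontalCompl, mem_horizontalCompl, hδ]
      refine ⟨?_, h.2⟩
      rcases eq_or_ne b c with rfl | hb
      · rw [Function.update_self]
        exact h.1
      · rw [Function.update_of_ne hb]
        exact h.2
    · ext ⟨a, b⟩
      rw [Finset.mem_inter, Finset.mem_sdiff, mem_horizontalCompl, mem_horizontalCompl, hδ]
      rcases eq_or_ne b c with rfl | hb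
      · simp [and_comm]
      · simp [hb, hγ]
end

section
/- Let p and q be positive integers and let Y be the simplicial complex of all subsets of Fin p × Fin q containing no horizontal path; its facets are the complements of graphs of vertical paths. Then Y is shellable: there is a linear ordering F₁, F₂, …, F_m of all the facets of Y such that for all 1 ≤ i < j ≤ m there exist k < j and an element v ∈ F_j with F_i ∩ F_j ⊆ F_k ∩ F_j and F_k ∩ F_j = F_j \ {v}. -/
/-- `F` contains no horizontal path: for every nondecreasing `β : Fin q → Fin p`,
the graph of `β` is not contained in `F`. -/
def containsNoHorizontalPath {p q : ℕ} (F : Finset (Fin p × Fin q)) : Prop :=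
  ∀ β : Fin q → Fin p, Monotone β → ∃ j : Fin q, (β j, j) ∉ F

/-- `F` is a facet (maximal face) of the complex `Y` of subsets of the grid
containing no horizontal path. -/
def isFacetY {p q : ℕ} (F : Finset (Fin p × Fin q)) : Prop :=
  containsNoHorizontalPath F ∧
    ∀ G : Finset (Fin p × Fin q), containsNoHorizontalPath G → F ⊆ G → G = F

/-- The complement of the graph of `α`. -/
def graphCompl {p q : ℕ} (α : Fin p → Fin q) : Finset (Fin p × Fin q) :=
  Finset.univ.filter fun x => α x.1 ≠ x.2

@[simp]
theorem mem_graphCompl {p q : ℕ} (α : Fin p → Fin q) (x : Fin p × Fin q) :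
    x ∈ graphCompl α ↔ α x.1 ≠ x.2 := by
  simp [graphCompl]

theorem eq_of_graphCompl_subset {p q : ℕ} {α β : Fin p → Fin q}
    (h : graphCompl α ⊆ graphCompl β) : α = β := by
  funext i
  by_contra hne
  have := h ((mem_graphCompl α (i, β i)).2 hne)
  simp at this

/-- A vertical path and a horizontal path always meet. -/
theorem containsNoHorizontalPath_graphCompl {p q : ℕ} (hp : 0 < p) {α : Fin p → Fin q}
    (hα : Monotone α) : containsNoHorizontalPath (graphCompl α) := by
  intro β hβ
  have hne : ∃ i, β (α i) ≤ i :=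
    ⟨⟨p - 1, by omega⟩, Fin.le_def.2 (Nat.le_sub_one_of_lt (β _).isLt)⟩
  obtain ⟨i, hi, hmin⟩ := wellFounded_lt.has_min {i | β (α i) ≤ i} hne
  have hfix : β (α i) = i :=
    le_antisymm hi (not_lt.1 (hmin (β (α i)) (hβ (hα hi))))
  exact ⟨α i, by simp [hfix]⟩

/-- A set containing no horizontal path misses some vertical path. -/
theorem containsNoHorizontalPath.exists_subset_graphCompl {p q : ℕ}
    {F : Finset (Fin p × Fin q)} (hF : containsNoHorizontalPath F) :
    ∃ α : Fin p → Fin q, Monotone α ∧ F ⊆ graphCompl α := by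
  let Q : Fin p → ℕ → Prop := fun i n =>
    ∃ β : Fin q → Fin p, Monotone β ∧ ∀ k : Fin q, k.val < n → (β k, k) ∈ F ∧ β k ≤ i
  have hQi : ∀ {i i' n}, i ≤ i' → Q i n → Q i' n := by
    rintro i i' n hi ⟨β, hβ, h⟩
    exact ⟨β, hβ, fun k hk => ⟨(h k hk).1, (h k hk).2.trans hi⟩⟩
  have hQn : ∀ {i n n'}, n ≤ n' → Q i n' → Q i n := by
    rintro i n n' hn ⟨β, hβ, h⟩
    exact ⟨β, hβ, fun k hk => h k (hk.trans_le hn)⟩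
  have hjump : ∀ i, ∃ j : Fin q, Q i j ∧ ¬ Q i (j + 1) := by
    intro i
    by_contra! hstep
    have hall : ∀ n ≤ q, Q i n := by
      intro n
      induction n with
      | zero => exact fun _ => ⟨fun _ => i, monotone_const, fun k hk => absurd hk (by simp)⟩
      | succ n ih => exact fun hn => hstep ⟨n, hn⟩ (ih (by omega))
    obtain ⟨β, hβ, h⟩ := hall q le_rfl
    obtain ⟨j, hj⟩ := hF β hβ
    exact hj (h j j.isLt).1
  choose α hα hα' using hjump
  refine ⟨α, ?_, ?_⟩
  · intro i i' hi
    by_contra! hlt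
    exact hα' i' (hQi hi (hQn (Fin.lt_def.1 hlt) (hα i)))
  · rintro ⟨i, j⟩ hmem
    rw [mem_graphCompl]
    intro hij
    obtain rfl : α i = j := hij
    obtain ⟨β, hβ, h⟩ := hα i
    refine hα' i ⟨fun k => if k < α i then β k else i, ?_, ?_⟩
    · intro k l hkl
      dsimp only
      split_ifs with hk hl hl
      · exact hβ hkl
      · exact (h k hk).2
      · exact absurd (hkl.trans_lt hl) hk
      · exact le_rfl
    · intro k hk
      dsimp only
      split_ifs with hk'
      · exact h k hk'
      · obtain rfl : k = α i := le_antisymm (Fin.le_def.2 (by omega)) (not_lt.1 hk')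
        exact ⟨hmem, le_rfl⟩

/-- The facets of `Y` are the complements of the vertical paths. -/
theorem isFacetY_iff {p q : ℕ} (hp : 0 < p) (F : Finset (Fin p × Fin q)) :
    isFacetY F ↔ ∃ α : Fin p → Fin q, Monotone α ∧ graphCompl α = F := by
  constructor
  · rintro ⟨hF, hmax⟩
    obtain ⟨α, hα, hsub⟩ := hF.exists_subset_graphCompl
    exact ⟨α, hα, hmax _ (containsNoHorizontalPath_graphCompl hp hα) hsub⟩
  · rintro ⟨α, hα, rfl⟩
    refine ⟨containsNoHorizontalPath_graphCompl hp hα, fun G hG hsub => ?_⟩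
    obtain ⟨β, -, hGβ⟩ := hG.exists_subset_graphCompl
    obtain rfl := eq_of_graphCompl_subset (hsub.trans hGβ)
    exact hGβ.antisymm hsub

/-- Lowering a vertical path at its first difference with a lexicographically smaller one
gives a vertical path. -/
theorem monotone_update_of_lex {p q : ℕ} {α β : Fin p → Fin q} (hα : Monotone α)
    (hβ : Monotone β) {i : Fin p} (heq : ∀ k < i, α k = β k) (hlt : α i < β i) :
    Monotone (Function.update β i (α i)) := by
  intro k l hkl
  rcases eq_or_ne k i with rfl | hk <;> rcases eq_or_ne l k with rfl | hl
  · exact le_rfl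
  · simpa [hl] using hlt.le.trans (hβ hkl)
  · exact le_rfl
  · rcases eq_or_ne l i with rfl | hl'
    · simpa [hk, ← heq k (lt_of_le_of_ne hkl hk)] using hα hkl
    · simpa [hk, hl'] using hβ hkl

theorem graphCompl_inter_update {p q : ℕ} (α β : Fin p → Fin q) (i : Fin p) :
    graphCompl α ∩ graphCompl β ⊆
      graphCompl (Function.update β i (α i)) ∩ graphCompl β := by
  rintro ⟨k, l⟩
  rcases eq_or_ne k i with rfl | hk <;> simp_all

theorem graphCompl_update_inter {p q : ℕ} (β : Fin p → Fin q) (i : Fin p) (a : Fin q) :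
    graphCompl (Function.update β i a) ∩ graphCompl β = graphCompl β \ {(i, a)} := by
  ext ⟨k, l⟩
  rcases eq_or_ne k i with rfl | hk
  · simp [and_comm, eq_comm]
  · simp [hk]

/-- The simplicial complex `Y` of subsets of `Fin p × Fin q` containing no horizontal
path is shellable: its facets can be ordered `L 0, L 1, …` so that for all `i < j`
there are `k < j` and `v ∈ L j` with `L i ∩ L j ⊆ L k ∩ L j` and `L k ∩ L j = L j \ {v}`. -/
theorem no_horizontal_path_complex_shellable (p q : ℕ) (hp : 0 < p) (hq : 0 < q) :
    ∃ (m : ℕ) (L : Fin m → Finset (Fin p × Fin q)),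
      Function.Injective L ∧
      (∀ F : Finset (Fin p × Fin q), isFacetY F ↔ ∃ i : Fin m, L i = F) ∧
      (∀ i j : Fin m, i < j → ∃ k : Fin m, k < j ∧ ∃ v ∈ L j,
        L i ∩ L j ⊆ L k ∩ L j ∧ L k ∩ L j = L j \ {v}) := by
  classical
  let S : Finset (Lex (Fin p → Fin q)) := Finset.univ.filter fun α => Monotone (ofLex α)
  let e := S.orderIsoOfFin rfl
  have hmono : ∀ i, Monotone (ofLex (e i).1) := fun i => (Finset.mem_filter.1 (e i).2).2
  have hsurj : ∀ α : Fin p → Fin q, Monotone α → ∃ i, (e i).1 = toLex α := fun α hα =>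
    ⟨e.symm ⟨toLex α, Finset.mem_filter.2 ⟨Finset.mem_univ _, hα⟩⟩, by simp⟩
  refine ⟨S.card, fun i => graphCompl (ofLex (e i).1), ?_, fun F => ?_, fun i j hij => ?_⟩
  · intro i j hij
    exact e.injective (Subtype.ext (ofLex.injective (eq_of_graphCompl_subset hij.subset)))
  · rw [isFacetY_iff hp]
    constructor
    · rintro ⟨α, hα, rfl⟩
      obtain ⟨i, hi⟩ := hsurj α hα
      exact ⟨i, by simp [hi]⟩
    · rintro ⟨i, rfl⟩
      exact ⟨_, hmono i, rfl⟩
  · obtain ⟨r, heq, hlt⟩ : (e i).1 < (e j).1 := e.strictMono hij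
    obtain ⟨k, hk⟩ := hsurj _ (monotone_update_of_lex (hmono i) (hmono j) heq hlt)
    refine ⟨k, ?_, (r, ofLex (e i).1 r), ?_, ?_, ?_⟩
    · rw [← e.lt_iff_lt, ← Subtype.coe_lt_coe, hk]
      exact Pi.toLex_update_lt_self_iff.2 hlt
    · simpa using hlt.ne'
    · simpa only [hk, ofLex_toLex] using graphCompl_inter_update _ _ r
    · simpa only [hk, ofLex_toLex] using graphCompl_update_inter _ r _
end
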